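/- arXiv:2601.02257 — 2 statements merged into one kernel-verified Lean document; each statement's English description precedes it below -/
import Mathlib

section
/- Let T ≥ 1 and 1 ≤ k ≤ T and D ≥ 1 be integers, let p ≥ 1 be real, let m ≥ 1, and let R be an arbitrary real m×T matrix. Then sens_p(R, S_{D,k}) ≤ max{ Σ_{d=1}^{D} sens_p(R, S_{1,k_d}) : k_1, …, k_D non-negative integers with k_1 + … + k_D = k }. Moreover, for any function U : [0,T] → ℝ that is concave and non-decreasing on [0,T] and satisfies sens_p(R, S_{1,j}) ≤ U(j) for every integer 0 ≤ j ≤ T, one has sens_p(R, S_{D,k}) ≤ D · U(⌈k/D⌉). -/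
/-- `Δ ∈ S_D`: every interval sum of `Δ` is bounded by `D` in absolute value. -/
def memS (T D : ℕ) (Δ : Fin T → ℤ) : Prop :=
  ∀ i j : Fin T, i ≤ j → |∑ t ∈ Finset.Icc i j, Δ t| ≤ (D : ℤ)

/-- The sensitivity vector set `S_{D,k}`. -/
def SDk (T D k : ℕ) : Set (Fin T → ℤ) :=
  {Δ | memS T D Δ ∧ (∑ t, |Δ t|) ≤ (k : ℤ)}

/-- The ℓp norm of a finite real vector. -/
noncomputable def pnorm (p : ℝ) {ι : Type} [Fintype ι] (x : ι → ℝ) : ℝ :=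
  (∑ i, |x i| ^ p) ^ (1 / p)

/-- `sens_p(R, S)`: the maximum of `‖RΔ‖_p` over `Δ ∈ S`. -/
noncomputable def sens (p : ℝ) {ι : Type} [Fintype ι] {T : ℕ}
    (R : Matrix ι (Fin T) ℝ) (S : Set (Fin T → ℤ)) : ℝ :=
  sSup ((fun Δ => pnorm p (R.mulVec fun t => (Δ t : ℝ))) '' S)

lemma aux_tele {T : ℕ} (Δ : Fin T → ℤ) (g : ℕ → ℤ)
    (h : ∀ t : Fin T, Δ t = g (t + 1) - g t) (i j : Fin T) (hij : i ≤ j) :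
    ∑ t ∈ Finset.Icc i j, Δ t = g (j + 1) - g i := by
  have h1 : ∑ t ∈ Finset.Icc i j, Δ t
      = ∑ s ∈ (Finset.Icc i j).map Fin.valEmbedding, (g (s + 1) - g s) := by
    rw [Finset.sum_map]
    exact Finset.sum_congr rfl fun t _ => h t
  rw [h1, Fin.map_valEmbedding_Icc]
  have h2 : Finset.Icc (i : ℕ) (j : ℕ) = Finset.Ico (i : ℕ) (j + 1) := by
    ext x; simp only [Finset.mem_Icc, Finset.mem_Ico]; omega
  rw [h2, Finset.sum_Ico_eq_sub _ (by have : (i : ℕ) ≤ j := hij; omega),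
    Finset.sum_range_sub, Finset.sum_range_sub]
  ring

/-- Level indicator. -/
def lev (q : ℤ) (d : ℕ) : ℤ := if (d : ℤ) < q then 1 else 0

lemma lev_sum (D : ℕ) : ∀ q : ℤ, 0 ≤ q → q ≤ D → ∑ d : Fin D, lev q d = q := by
  intro q h0 h1
  rw [Fin.sum_univ_eq_sum_range (fun d => lev q d)]
  have : ∀ n : ℕ, ∑ d ∈ Finset.range n, lev q d = min (n : ℤ) q := by
    intro n
    induction n with
    | zero => simp [h0]
    | succ n ih =>
      rw [Finset.sum_range_succ, ih]
      unfold lev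
      push_cast
      split_ifs <;> omega
  rw [this]; omega

lemma lev_abs_le (D : ℕ) (a b : ℤ) (ha : 0 ≤ a) (hb : b ≤ D) (hab : a ≤ b) :
    ∑ d : Fin D, |lev b d - lev a d| = b - a := by
  rw [← lev_sum D b (by omega) hb]
  conv_rhs => rw [← lev_sum D a ha (by omega)]
  rw [← Finset.sum_sub_distrib, lev_sum D b (by omega) hb]
  refine Finset.sum_congr rfl fun d _ => ?_
  apply abs_of_nonneg
  unfold lev
  split_ifs <;> omega

lemma lev_abs (D : ℕ) (a b : ℤ) (ha : 0 ≤ a) (hb : 0 ≤ b) (ha' : a ≤ D) (hb' : b ≤ D) :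
    ∑ d : Fin D, |lev b d - lev a d| = |b - a| := by
  rcases le_total a b with h | h
  · rw [lev_abs_le D a b ha hb' h, abs_of_nonneg (by omega)]
  · rw [abs_sub_comm b a, ← (abs_of_nonneg (by omega : 0 ≤ a - b)).symm,
      ← lev_abs_le D b a hb ha' h]
    exact Finset.sum_congr rfl fun d _ => abs_sub_comm _ _

/-- Decomposition into unit levels. -/
lemma decomp {T D : ℕ} (Δ : Fin T → ℤ) (h : memS T D Δ) :
    ∃ E : Fin D → Fin T → ℤ, (∀ d, memS T 1 (E d)) ∧ (∀ t, Δ t = ∑ d, E d t) ∧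
      (∀ t, ∑ d, |E d t| = |Δ t|) := by
  classical
  let P : ℕ → ℤ := fun i => ∑ s ∈ Finset.range i, if hs : s < T then Δ ⟨s, hs⟩ else 0
  have hP : ∀ t : Fin T, Δ t = P (t + 1) - P t := by
    intro t
    simp [P, Finset.sum_range_succ]
  have hPd : ∀ i j : ℕ, i ≤ j → j ≤ T → |P j - P i| ≤ D := by
    intro i j hij hj
    rcases Nat.eq_or_lt_of_le hij with rfl | hlt
    · simp
    · have := h ⟨i, by omega⟩ ⟨j - 1, by omega⟩ (by simp [Fin.le_def]; omega)
      rw [aux_tele Δ P hP _ _ (by simp [Fin.le_def]; omega)] at this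
      have e : j - 1 + 1 = j := by omega
      simpa [e] using this
  obtain ⟨i0, hi0, hmin⟩ := Finset.exists_min_image (Finset.range (T + 1)) P ⟨0, by simp⟩
  simp only [Finset.mem_range] at hi0 hmin
  let Q : ℕ → ℤ := fun i => P i - P i0
  have hQ0 : ∀ i ≤ T, 0 ≤ Q i := fun i hi => by
    have := hmin i (by omega)
    simp only [Q]; omega
  have hQD : ∀ i ≤ T, Q i ≤ D := fun i hi => by
    simp only [Q]
    rcases le_total i0 i with h' | h'
    · exact (abs_le.1 (hPd _ _ h' hi)).2
    · have := (abs_le.1 (hPd _ _ h' (by omega))).1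
      omega
  have hQ : ∀ t : Fin T, Δ t = Q (t + 1) - Q t := fun t => by
    rw [hP t]; simp only [Q]; ring
  refine ⟨fun d t => lev (Q (t + 1)) d - lev (Q t) d, ?_, ?_, ?_⟩
  · intro d i j hij
    rw [aux_tele _ (fun n => lev (Q n) d) (fun t => rfl) i j hij]
    unfold lev
    split_ifs <;> simp
  · intro t
    have := t.2
    rw [Finset.sum_sub_distrib, lev_sum D _ (hQ0 _ (by omega)) (hQD _ (by omega)),
      lev_sum D _ (hQ0 _ (by omega)) (hQD _ (by omega)), hQ]
  · intro t
    have := t.2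
    rw [lev_abs D _ _ (hQ0 _ (by omega)) (hQ0 _ (by omega)) (hQD _ (by omega))
      (hQD _ (by omega)), ← hQ]

lemma SDk_finite (T D k : ℕ) : (SDk T D k).Finite := by
  apply (Set.finite_Icc (fun _ : Fin T => -(k : ℤ)) (fun _ => (k : ℤ))).subset
  rintro Δ ⟨-, h⟩
  have : ∀ t, |Δ t| ≤ k := fun t =>
    (Finset.single_le_sum (f := fun t => |Δ t|) (fun _ _ => abs_nonneg _)
      (Finset.mem_univ t)).trans h
  exact ⟨fun t => (abs_le.1 (this t)).1, fun t => (abs_le.1 (this t)).2⟩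

lemma SDk_nonempty (T D k : ℕ) : (SDk T D k).Nonempty :=
  ⟨0, by intro i j _; simp, by simp⟩

lemma le_sens {T D k m : ℕ} (p : ℝ) (R : Matrix (Fin m) (Fin T) ℝ) {Δ : Fin T → ℤ}
    (h : Δ ∈ SDk T D k) : pnorm p (R.mulVec fun t => (Δ t : ℝ)) ≤ sens p R (SDk T D k) :=
  le_csSup ((SDk_finite T D k).image _).bddAbove (Set.mem_image_of_mem _ h)

lemma sens_mono {T D k l m : ℕ} (p : ℝ) (R : Matrix (Fin m) (Fin T) ℝ) (h : k ≤ l) :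
    sens p R (SDk T D k) ≤ sens p R (SDk T D l) := by
  apply csSup_le_csSup ((SDk_finite T D l).image _).bddAbove ((SDk_nonempty T D k).image _)
  apply Set.image_mono
  rintro Δ ⟨h1, h2⟩
  exact ⟨h1, h2.trans (by exact_mod_cast h)⟩

lemma pnorm_sum {p : ℝ} (hp : 1 ≤ p) {m : ℕ} {α : Type} (s : Finset α) (f : α → Fin m → ℝ) :
    pnorm p (fun i => ∑ d ∈ s, f d i) ≤ ∑ d ∈ s, pnorm p (f d) := by
  classical
  induction s using Finset.induction_on with
  | empty =>
    have h1 : p ≠ 0 := by linarith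
    simp [pnorm, Real.zero_rpow h1, Real.zero_rpow (inv_ne_zero h1)]
  | insert a s ha ih =>
    rw [Finset.sum_insert ha]
    simp only [Finset.sum_insert ha]
    refine le_trans ?_ (add_le_add le_rfl ih)
    exact Real.Lp_add_le Finset.univ _ _ hp

lemma bound_bdd {T D k m : ℕ} (p : ℝ) (R : Matrix (Fin m) (Fin T) ℝ) :
    BddAbove {x : ℝ | ∃ ks : Fin D → ℕ, (∑ d, ks d = k) ∧
          x = ∑ d, sens p R (SDk T 1 (ks d))} := by
  refine ⟨∑ d : Fin D, sens p R (SDk T 1 k), ?_⟩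
  rintro x ⟨ks, hks, rfl⟩
  refine Finset.sum_le_sum fun d _ => sens_mono p R ?_
  rw [← hks]
  exact Finset.single_le_sum (f := ks) (fun _ _ => Nat.zero_le _) (Finset.mem_univ d)

lemma main_bound {T D k m : ℕ} (hD : 1 ≤ D) {p : ℝ} (hp : 1 ≤ p)
    (R : Matrix (Fin m) (Fin T) ℝ) {Δ : Fin T → ℤ} (h : Δ ∈ SDk T D k) :
    ∃ ks : Fin D → ℕ, (∑ d, ks d = k) ∧
      pnorm p (R.mulVec fun t => (Δ t : ℝ)) ≤ ∑ d, sens p R (SDk T 1 (ks d)) := by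
  classical
  obtain ⟨h1, h2⟩ := h
  obtain ⟨E, hE1, hE2, hE3⟩ := decomp Δ h1
  let js : Fin D → ℕ := fun d => (∑ t, |E d t|).toNat
  have hjs : ∀ d, (js d : ℤ) = ∑ t, |E d t| := fun d =>
    Int.toNat_of_nonneg (Finset.sum_nonneg fun _ _ => abs_nonneg _)
  have hsum : ∑ d, js d ≤ k := by
    zify
    simp only [hjs]
    rw [Finset.sum_comm]
    simpa only [hE3] using h2
  let d0 : Fin D := ⟨0, by omega⟩
  refine ⟨fun d => js d + if d = d0 then k - ∑ d, js d else 0, ?_, ?_⟩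
  · rw [Finset.sum_add_distrib]
    simp only [Finset.sum_ite_eq', Finset.mem_univ, if_true]
    omega
  · have e : (R.mulVec fun t => (Δ t : ℝ))
        = fun i => ∑ d, (R.mulVec fun t => (E d t : ℝ)) i := by
      ext i
      simp only [Matrix.mulVec, dotProduct, hE2]
      rw [Finset.sum_comm]
      push_cast
      simp only [Finset.mul_sum]
    rw [e]
    refine (pnorm_sum hp _ _).trans (Finset.sum_le_sum fun d _ => le_sens p R ⟨hE1 d, ?_⟩)
    rw [← hjs]
    push_cast
    split_ifs <;> simp

theorem stmt5 (T k D m : ℕ) (hk1 : 1 ≤ k) (hkT : k ≤ T) (hD : 1 ≤ D) (hm : 1 ≤ m)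
    (p : ℝ) (hp : 1 ≤ p) (R : Matrix (Fin m) (Fin T) ℝ) :
    sens p R (SDk T D k) ≤
        sSup {x : ℝ | ∃ ks : Fin D → ℕ, (∑ d, ks d = k) ∧
          x = ∑ d, sens p R (SDk T 1 (ks d))} ∧
      ∀ U : ℝ → ℝ, ConcaveOn ℝ (Set.Icc (0 : ℝ) (T : ℝ)) U →
        MonotoneOn U (Set.Icc (0 : ℝ) (T : ℝ)) →
        (∀ j : ℕ, j ≤ T → sens p R (SDk T 1 j) ≤ U (j : ℝ)) →
        sens p R (SDk T D k) ≤ (D : ℝ) * U ((⌈(k : ℝ) / (D : ℝ)⌉ : ℤ) : ℝ) := by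
  constructor
  · apply csSup_le ((SDk_nonempty T D k).image _)
    rintro _ ⟨Δ, h, rfl⟩
    obtain ⟨ks, h1, h2⟩ := main_bound hD hp R h
    exact h2.trans (le_csSup (bound_bdd p R) ⟨ks, h1, rfl⟩)
  · intro U hc hmono hU
    apply csSup_le ((SDk_nonempty T D k).image _)
    rintro _ ⟨Δ, h, rfl⟩
    obtain ⟨ks, h1, h2⟩ := main_bound hD hp R h
    refine h2.trans ?_
    have hks : ∀ d, ks d ≤ T := fun d => by
      refine le_trans ?_ hkT
      rw [← h1]
      exact Finset.single_le_sum (f := ks) (fun _ _ => Nat.zero_le _) (Finset.mem_univ d)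
    have hDpos : (0 : ℝ) < D := by exact_mod_cast hD
    have hD1 : (1 : ℝ) ≤ D := by exact_mod_cast hD
    have hkT' : (k : ℝ) ≤ T := by exact_mod_cast hkT
    have J := hc.le_map_sum (t := Finset.univ) (w := fun _ : Fin D => (D : ℝ)⁻¹)
      (p := fun d => (ks d : ℝ)) (fun _ _ => by positivity)
      (by simp [hDpos.ne']) (fun d _ => ⟨by positivity, by exact_mod_cast hks d⟩)
    simp only [smul_eq_mul, ← Finset.mul_sum] at J
    rw [← Nat.cast_sum, h1, inv_mul_le_iff₀ hDpos] at J
    have hkD : (k : ℝ) / D ≤ k := div_le_self (by positivity) hD1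
    have hceil : ((⌈(k : ℝ) / (D : ℝ)⌉ : ℤ) : ℝ) ≤ k := by
      have : ⌈(k : ℝ) / (D : ℝ)⌉ ≤ (k : ℤ) := Int.ceil_le.2 (by exact_mod_cast hkD)
      exact_mod_cast this
    have hle := Int.le_ceil ((k : ℝ) / (D : ℝ))
    have h0 : 0 ≤ (k : ℝ) / D := by positivity
    have hm2 := hmono (a := (k : ℝ) / D) (b := ((⌈(k : ℝ) / (D : ℝ)⌉ : ℤ) : ℝ))
      ⟨h0, by linarith⟩ ⟨by linarith, by linarith⟩ hle
    calc ∑ d, sens p R (SDk T 1 (ks d)) ≤ ∑ d, U (ks d : ℝ) :=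
          Finset.sum_le_sum fun d _ => hU _ (hks d)
      _ ≤ D * U ((D : ℝ)⁻¹ * k) := J
      _ ≤ _ := by
        rw [inv_mul_eq_div]
        exact mul_le_mul_of_nonneg_left hm2 hDpos.le
end

section
/- Let b and T be integers with 3 ≤ b ≤ T, let 1 ≤ k ≤ T, let h = ⌈log_b T⌉, let k̃ = min(k, b^{h−1}), and let p ≥ 1 be real. Then k̃·(⌈log_b T⌉ − ⌈log_b k̃⌉ − 1/b) ≤ sens_p(R̂_b, S_{1,k})^p ≤ k·(⌈log_b(T/k)⌉ + 2). If additionally k ≤ T/b, then also sens_p(R̂_b, S_{1,k})^p ≥ k·(⌊log_b(T/k)⌋ − 1/b). -/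
/-- The reduced-tree matrix `R̂_b` of the complete `b`-ary tree of height `h`,
restricted to its first `T` columns: entry `1` iff the node `(ℓ, j)` is counted
(the root, or not the left-most child of its parent) and leaf `t` lies in its
subtree. Rows are indexed by node coordinates `(ℓ, j)`; rows whose coordinates
do not correspond to a tree node are identically zero. -/
def nodeMatrixHatT (b h T : ℕ) : Matrix (Fin (h + 1) × Fin (b ^ h)) (Fin T) ℝ :=
  fun q t =>
    if ((q.1 : ℕ) = h ∨ (q.2 : ℕ) % b ≠ 0) ∧
        (q.2 : ℕ) * b ^ (q.1 : ℕ) ≤ (t : ℕ) ∧ (t : ℕ) < ((q.2 : ℕ) + 1) * b ^ (q.1 : ℕ) then 1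
    else 0

open Finset in
theorem memS_Ico {T : ℕ} {Δ : Fin T → ℤ} (hΔ : memS T 1 Δ) (a c : ℕ) :
    |∑ t : Fin T, if a ≤ (t:ℕ) ∧ (t:ℕ) < c then Δ t else 0| ≤ 1 := by
  classical
  rw [← Finset.sum_filter]
  by_cases hne : a < min c T
  · have h1 : a < T := lt_of_lt_of_le hne (min_le_right _ _)
    have h2 : min c T - 1 < T := by omega
    have := hΔ ⟨a, h1⟩ ⟨min c T - 1, h2⟩ (by simp only [Fin.mk_le_mk]; omega)
    have he : (univ.filter fun t : Fin T => a ≤ (t:ℕ) ∧ (t:ℕ) < c)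
        = Finset.Icc (⟨a, h1⟩ : Fin T) ⟨min c T - 1, h2⟩ := by
      ext t
      have := t.2
      simp only [mem_filter, mem_univ, true_and, mem_Icc, Fin.le_def]
      omega
    rw [he]
    simpa using this
  · have he : (univ.filter fun t : Fin T => a ≤ (t:ℕ) ∧ (t:ℕ) < c) = ∅ := by
      ext t
      have := t.2
      simp only [mem_filter, mem_univ, true_and, notMem_empty, iff_false]
      omega
    rw [he]; simp

/-- Integer node value. -/
def nodeVal (b T : ℕ) (Δ : Fin T → ℤ) (l j : ℕ) : ℤ :=
  ∑ t : Fin T, if j * b ^ l ≤ (t:ℕ) ∧ (t:ℕ) < (j+1) * b ^ l then Δ t else 0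

theorem mulVec_eq (b h T : ℕ) (Δ : Fin T → ℤ) (q : Fin (h + 1) × Fin (b ^ h)) :
    (nodeMatrixHatT b h T).mulVec (fun t => (Δ t : ℝ)) q =
      if ((q.1 : ℕ) = h ∨ (q.2 : ℕ) % b ≠ 0) then (nodeVal b T Δ q.1 q.2 : ℝ) else 0 := by
  unfold nodeMatrixHatT nodeVal Matrix.mulVec dotProduct
  split_ifs with hc
  · push_cast
    refine Finset.sum_congr rfl fun t _ => ?_
    simp only [hc, true_and]
    split_ifs <;> simp
  · simp [hc]

theorem abs_le_one_rpow (z : ℤ) (hz : |z| ≤ 1) (p : ℝ) (hp : 1 ≤ p) :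
    |(z:ℝ)| ^ p = if z ≠ 0 then 1 else 0 := by
  have : z = -1 ∨ z = 0 ∨ z = 1 := by
    have := abs_le.1 hz; omega
  rcases this with rfl | rfl | rfl
  · simp
  · have : p ≠ 0 := by linarith
    simp [this]
  · simp

open Finset Classical in
/-- The nonzero counted nodes. -/
noncomputable def nzNodes (b h T : ℕ) (Δ : Fin T → ℤ) : Finset (Fin (h + 1) × Fin (b ^ h)) :=
  univ.filter fun q => ((q.1 : ℕ) = h ∨ (q.2 : ℕ) % b ≠ 0) ∧ nodeVal b T Δ q.1 q.2 ≠ 0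

theorem pnorm_eq (b h T k : ℕ) (Δ : Fin T → ℤ) (hΔ : Δ ∈ SDk T 1 k) (p : ℝ) (hp : 1 ≤ p) :
    pnorm p ((nodeMatrixHatT b h T).mulVec (fun t => (Δ t : ℝ))) =
      ((nzNodes b h T Δ).card : ℝ) ^ (1 / p) := by
  classical
  unfold pnorm
  congr 1
  have : p ≠ 0 := by linarith
  rw [nzNodes, Finset.card_filter]
  push_cast
  refine Finset.sum_congr rfl fun q _ => ?_
  rw [mulVec_eq]
  by_cases hc : ((q.1 : ℕ) = h ∨ (q.2 : ℕ) % b ≠ 0)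
  · simp only [hc, if_true, true_and]
    have hz : |nodeVal b T Δ q.1 q.2| ≤ 1 := memS_Ico hΔ.1 _ _
    rw [abs_le_one_rpow _ hz p hp]
  · simp [hc, this]

theorem zero_mem_SDk (T k : ℕ) : (0 : Fin T → ℤ) ∈ SDk T 1 k := by
  refine ⟨fun i j _ => by simp, by simp⟩

theorem sens_le (b h T k : ℕ) (p : ℝ) (hp : 1 ≤ p) (N : ℕ)
    (hN : ∀ Δ ∈ SDk T 1 k, (nzNodes b h T Δ).card ≤ N) :
    sens p (nodeMatrixHatT b h T) (SDk T 1 k) ^ p ≤ N := by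
  have hp0 : 0 < p := by linarith
  have h1 : sens p (nodeMatrixHatT b h T) (SDk T 1 k) ≤ (N:ℝ) ^ (1/p) := by
    refine csSup_le (Set.Nonempty.image _ ⟨0, zero_mem_SDk T k⟩) ?_
    rintro _ ⟨Δ, hΔ, rfl⟩
    simp only
    rw [pnorm_eq b h T k Δ hΔ p hp]
    exact Real.rpow_le_rpow (by positivity) (by exact_mod_cast hN Δ hΔ) (by positivity)
  have h0 : 0 ≤ sens p (nodeMatrixHatT b h T) (SDk T 1 k) := by
    apply Real.sSup_nonneg
    rintro _ ⟨Δ, hΔ, rfl⟩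
    simp only
    rw [pnorm_eq b h T k Δ hΔ p hp]
    positivity
  calc _ ≤ ((N:ℝ) ^ (1/p)) ^ p := Real.rpow_le_rpow h0 h1 hp0.le
    _ = N := by
      rw [← Real.rpow_mul (by positivity)]; field_simp; simp

theorem le_sens_s17 (b h T k : ℕ) (p : ℝ) (hp : 1 ≤ p)
    (Δ : Fin T → ℤ) (hΔ : Δ ∈ SDk T 1 k) :
    ((nzNodes b h T Δ).card : ℝ) ≤ sens p (nodeMatrixHatT b h T) (SDk T 1 k) ^ p := by
  have hp0 : 0 < p := by linarith
  have hb : BddAbove ((fun Δ : Fin T → ℤ =>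
      pnorm p ((nodeMatrixHatT b h T).mulVec fun t => (Δ t : ℝ))) '' SDk T 1 k) := by
    refine ⟨((Finset.univ : Finset (Fin (h + 1) × Fin (b ^ h))).card : ℝ) ^ (1/p), ?_⟩
    rintro _ ⟨Δ, hΔ, rfl⟩
    simp only
    rw [pnorm_eq b h T k Δ hΔ p hp]
    exact Real.rpow_le_rpow (by positivity)
      (by exact_mod_cast Finset.card_le_card (Finset.subset_univ _)) (by positivity)
  have h1 := le_csSup hb ⟨Δ, hΔ, rfl⟩
  simp only at h1
  rw [pnorm_eq b h T k Δ hΔ p hp] at h1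
  calc ((nzNodes b h T Δ).card : ℝ) = (((nzNodes b h T Δ).card : ℝ) ^ (1/p)) ^ p := by
        rw [← Real.rpow_mul (by positivity)]; field_simp; simp
    _ ≤ _ := Real.rpow_le_rpow (by positivity) h1 hp0.le

open Finset in
theorem supp_card {T k : ℕ} {Δ : Fin T → ℤ} (hΔ : Δ ∈ SDk T 1 k) :
    (univ.filter fun t => Δ t ≠ 0).card ≤ k := by
  have h2 := hΔ.2
  have : (((univ.filter fun t => Δ t ≠ 0).card : ℕ) : ℤ) ≤ ∑ t, |Δ t| := by
    rw [card_filter]; push_cast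
    refine sum_le_sum fun t _ => ?_
    split_ifs with h
    · exact Int.one_le_abs h
    · positivity
  exact_mod_cast this.trans h2

open Finset in
theorem nz_exists {b T : ℕ} {Δ : Fin T → ℤ} {l j : ℕ} (hn : nodeVal b T Δ l j ≠ 0) :
    ∃ t : Fin T, Δ t ≠ 0 ∧ j * b ^ l ≤ t ∧ t < (j+1) * b ^ l := by
  obtain ⟨t, _, ht⟩ := exists_ne_zero_of_sum_ne_zero hn
  rw [ite_ne_right_iff] at ht
  exact ⟨t, ht.2, ht.1⟩

open Finset in
theorem upper (b h T k c : ℕ) (hb : 2 ≤ b) (hc : T ≤ k * b ^ c)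
    (Δ : Fin T → ℤ) (hΔ : Δ ∈ SDk T 1 k) : (nzNodes b h T Δ).card ≤ k * (c + 1) := by
  classical
  set N := nzNodes b h T Δ with hN
  have hmem : ∀ q ∈ N, ((q.1 : ℕ) = h ∨ (q.2 : ℕ) % b ≠ 0) ∧ nodeVal b T Δ q.1 q.2 ≠ 0 := by
    intro q hq; simpa [hN, nzNodes] using hq
  have hsplit := card_filter_add_card_filter_not (s := N) (fun q => (q.1:ℕ) < c)
  have hlow : (N.filter fun q => (q.1:ℕ) < c).card ≤ c * k := by
    calc (N.filter fun q => (q.1:ℕ) < c).card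
        = ((N.filter fun q => (q.1:ℕ) < c).image fun q => ((q.1:ℕ), (q.2:ℕ))).card := by
          rw [card_image_of_injective]
          rintro ⟨a, b⟩ ⟨c, d⟩ h
          simp only [Prod.mk.injEq] at h
          ext <;> simp [h]
      _ ≤ (((range c) ×ˢ (univ.filter fun t => Δ t ≠ 0)).image
            fun x => (x.1, (x.2:ℕ) / b ^ x.1)).card := by
          apply card_le_card
          intro y hy
          simp only [mem_image, mem_filter] at hy
          obtain ⟨q, ⟨hq, hqc⟩, rfl⟩ := hy
          obtain ⟨t, ht, h1, h2⟩ := nz_exists (hmem q hq).2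
          simp only [mem_image, mem_product, mem_range, mem_filter, mem_univ, true_and]
          refine ⟨((q.1:ℕ), t), ⟨hqc, ht⟩, ?_⟩
          simp only [Prod.mk.injEq, true_and]
          exact Nat.div_eq_of_lt_le h1 h2
      _ ≤ _ := card_image_le
      _ ≤ c * k := by
          rw [card_product, card_range]
          exact Nat.mul_le_mul_left _ (supp_card hΔ)
  have hhigh : (N.filter fun q => ¬ (q.1:ℕ) < c).card ≤ k := by
    have key : ∀ q ∈ (N.filter fun q => ¬ (q.1:ℕ) < c), ∀ r ∈ (N.filter fun q => ¬ (q.1:ℕ) < c),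
        (q.1:ℕ) < r.1 → (q.2:ℕ) * b ^ ((q.1:ℕ) - c) ≠ (r.2:ℕ) * b ^ ((r.1:ℕ) - c) := by
      intro q hq r hr hlt he
      rw [mem_filter] at hq hr
      obtain ⟨d, hd⟩ : ∃ d, (r.1:ℕ) - c = (q.1 - c) + (d + 1) :=
        ⟨(r.1:ℕ) - q.1 - 1, by omega⟩
      rw [hd, pow_add, mul_left_comm, mul_comm] at he
      have := Nat.eq_of_mul_eq_mul_left (by positivity) he
      rcases (hmem q hq.1).1 with h1 | h1
      · have := r.1.2; omega
      · apply h1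
        rw [this, pow_succ, ← mul_assoc]
        simp
    calc _ ≤ (range k).card := by
          apply card_le_card_of_injOn (fun q => (q.2:ℕ) * b ^ ((q.1:ℕ) - c))
          · intro q hq
            rw [mem_coe, mem_filter] at hq
            obtain ⟨t, ht, h1, h2⟩ := nz_exists (hmem q hq.1).2
            have h3 : (q.2:ℕ) * b ^ (q.1:ℕ) < k * b ^ c := by
              have := t.2; omega
            have h4 : (q.1:ℕ) = (q.1 - c) + c := by omega
            rw [h4, pow_add, ← mul_assoc] at h3
            simpa using lt_of_mul_lt_mul_right h3 (by positivity)
          · intro q hq r hr he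
            simp only at he
            rcases lt_trichotomy (q.1:ℕ) r.1 with h1 | h1 | h1
            · exact absurd he (key q hq r hr h1)
            · rw [h1] at he
              have := Nat.eq_of_mul_eq_mul_right (by positivity) he
              ext <;> assumption
            · exact absurd he.symm (key r hr q hq h1)
      _ = k := card_range k
  calc N.card = _ := hsplit.symm
    _ ≤ c * k + k := add_le_add hlow hhigh
    _ = k * (c+1) := by ring

open Finset in
theorem sum_tele {T : ℕ} (f : ℕ → ℤ) (a c : ℕ) (hac : a ≤ c) (hc : c ≤ T) :
    (∑ t : Fin T, if a ≤ (t:ℕ) ∧ (t:ℕ) < c then f (t+1) - f t else 0) = f c - f a := by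
  rw [Fin.sum_univ_eq_sum_range (fun t => if a ≤ t ∧ t < c then f (t+1) - f t else 0),
    ← sum_filter]
  have : (range T).filter (fun t => a ≤ t ∧ t < c) = Ico a c := by
    ext t; simp only [mem_filter, mem_range, mem_Ico]; omega
  rw [this, sum_Ico_sub f hac]

open Finset in
theorem sum_Icc_tele {T : ℕ} (f : ℕ → ℤ) (i j : Fin T) (hij : i ≤ j) :
    (∑ t ∈ Finset.Icc i j, (f (t+1) - f t)) = f (j+1) - f i := by
  rw [← sum_tele (T := T) f i (j+1) (by rw [Fin.le_def] at hij; omega) (by omega), ← sum_filter]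
  congr 1
  ext t
  simp only [mem_filter, mem_univ, true_and, mem_Icc, Fin.le_def]
  omega

/-- counter of selected leaves below `n` -/
def cnt (M s k n : ℕ) : ℕ := min (n / M) (s + k) - s

/-- the alternating vector -/
def altVec (M s k T : ℕ) : Fin T → ℤ := fun t =>
  ((cnt M s k (t+1) % 2 : ℕ) : ℤ) - ((cnt M s k t % 2 : ℕ) : ℤ)

theorem altVec_mem (M s k k' T : ℕ) (hk : k ≤ k') : altVec M s k T ∈ SDk T 1 k' := by
  constructor
  · intro i j hij
    have := sum_Icc_tele (fun n => ((cnt M s k n % 2 : ℕ) : ℤ)) i j hij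
    unfold altVec
    rw [this, abs_le]
    push_cast
    constructor <;> omega
  · have h1 : ∀ t : Fin T, |altVec M s k T t| ≤ (cnt M s k (t+1) : ℤ) - (cnt M s k t : ℤ) := by
      intro t
      have : cnt M s k t ≤ cnt M s k (t+1) := by
        unfold cnt
        have : (t:ℕ) / M ≤ (t+1) / M := Nat.div_le_div_right (by omega)
        omega
      unfold altVec
      rw [abs_le]
      constructor <;> omega
    calc _ ≤ ∑ t : Fin T, ((cnt M s k (t+1) : ℤ) - (cnt M s k t : ℤ)) :=
          Finset.sum_le_sum fun t _ => h1 t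
      _ = (cnt M s k T : ℤ) - cnt M s k 0 := by
          rw [Fin.sum_univ_eq_sum_range
            (fun t => (cnt M s k (t+1) : ℤ) - (cnt M s k t : ℤ)), 
            Finset.sum_range_sub (fun t => (cnt M s k t : ℤ))]
      _ ≤ k' := by
          unfold cnt; omega

theorem altVec_node (b T m s k l i : ℕ) (hb : 2 ≤ b) (hl : l ≤ m) (hs : s ≤ i) (hi : i < s + k)
    (hT : (s + k) * b ^ m ≤ T) :
    nodeVal b T (altVec (b ^ m) s k T) l ((i+1) * b ^ (m - l) - 1) ≠ 0 := by
  obtain ⟨d, rfl⟩ : ∃ d, m = d + l := ⟨m - l, by omega⟩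
  have hd : d + l - l = d := by omega
  rw [hd]
  have hpd : 0 < b ^ d := by positivity
  have hpl : 0 < b ^ l := by positivity
  have hge : 1 ≤ (i+1) * b ^ d := Nat.mul_pos (by omega) hpd
  have e1 : ((i+1) * b ^ d - 1 + 1) * b ^ l = (i+1) * b ^ (d + l) := by
    rw [Nat.sub_add_cancel hge, pow_add, mul_assoc]
  have e2 : ((i+1) * b ^ d - 1) * b ^ l = (i+1) * b ^ (d + l) - b ^ l := by
    rw [Nat.sub_mul, pow_add, mul_assoc, one_mul]
  have hle : b ^ l ≤ b ^ (d + l) := Nat.pow_le_pow_right (by omega) (by omega)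
  have hiT : (i+1) * b ^ (d+l) ≤ T := le_trans (Nat.mul_le_mul_right _ (by omega)) hT
  unfold nodeVal altVec
  rw [e1, e2, sum_tele (fun n => ((cnt (b ^ (d+l)) s k n % 2 : ℕ) : ℤ)) _ _ (Nat.sub_le _ _) hiT]
  have d1 : (i+1) * b ^ (d + l) / b ^ (d+l) = i + 1 := Nat.mul_div_cancel _ (by positivity)
  have d2 : ((i+1) * b ^ (d + l) - b ^ l) / b ^ (d+l) = i := by
    apply Nat.div_eq_of_lt_le
    · have : (i+1) * b ^ (d+l) = i * b ^ (d+l) + b ^ (d+l) := by ring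
      omega
    · have : 0 < (i+1) * b ^ (d + l) := by positivity
      omega
  unfold cnt
  rw [d1, d2]
  omega

theorem mod_pred (b x e : ℕ) (hb : 2 ≤ b) (hx : 1 ≤ x) (he : 1 ≤ e) :
    (x * b ^ e - 1) % b ≠ 0 := by
  obtain ⟨e', rfl⟩ : ∃ e', e = e' + 1 := ⟨e - 1, by omega⟩
  intro h0
  have h1 : b ∣ x * b ^ (e'+1) - 1 := Nat.dvd_of_mod_eq_zero h0
  have h2 : b ∣ x * b ^ (e'+1) := by
    rw [pow_succ, ← mul_assoc]; exact Dvd.intro_left _ rfl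
  have h3 : 1 ≤ x * b ^ (e'+1) := Nat.mul_pos (by omega) (by positivity)
  have h4 := (Nat.dvd_sub h2 h1)
  rw [Nat.sub_sub_self h3] at h4
  have := Nat.le_of_dvd one_pos h4
  omega

open Finset in
theorem lower (b h T m s k : ℕ) (hb : 2 ≤ b) (hm : m < h) (hTh : T ≤ b ^ h)
    (hT : (s + k) * b ^ m ≤ T) :
    k * m + ((Ico s (s+k)).filter fun i => i % b ≠ 0).card ≤
      (nzNodes b h T (altVec (b ^ m) s k T)).card := by
  classical
  set A : Finset (ℕ × ℕ) := (range m) ×ˢ (Ico s (s+k)) with hA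
  set B : Finset (ℕ × ℕ) := ({m} : Finset ℕ) ×ˢ ((Ico s (s+k)).filter fun i => i % b ≠ 0) with hB
  have hdis : Disjoint A B := by
    rw [disjoint_left]
    intro x hx hx'
    simp only [hA, hB, mem_product, mem_range, mem_singleton] at hx hx'
    omega
  have hcard : (A ∪ B).card = k * m + ((Ico s (s+k)).filter fun i => i % b ≠ 0).card := by
    rw [card_union_of_disjoint hdis, hA, hB, card_product, card_product]
    simp [mul_comm]
  rw [← hcard]
  have hbnd : ∀ x ∈ A ∪ B, x.1 ≤ m ∧ s ≤ x.2 ∧ x.2 < s + k ∧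
      ((x.2+1) * b ^ (m - x.1) - 1) % b ≠ 0 := by
    intro x hx
    rw [mem_union] at hx
    rcases hx with hx | hx
    · simp only [hA, mem_product, mem_range, mem_Ico] at hx
      exact ⟨by omega, hx.2.1, hx.2.2, mod_pred _ _ _ hb (by omega) (by omega)⟩
    · simp only [hB, mem_product, mem_singleton, mem_filter, mem_Ico] at hx
      refine ⟨by omega, hx.2.1.1, hx.2.1.2, ?_⟩
      rw [hx.1]; simpa using hx.2.2
  have hj : ∀ x ∈ A ∪ B, (x.2+1) * b ^ (m - x.1) - 1 < b ^ h := by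
    intro x hx
    obtain ⟨h1, h2, h3, -⟩ := hbnd x hx
    have h4 : (x.2+1) * b ^ (m - x.1) ≤ (s+k) * b ^ m :=
      Nat.mul_le_mul (by omega) (Nat.pow_le_pow_right (by omega) (by omega))
    have : 0 < (x.2+1) * b ^ (m - x.1) := by positivity
    omega
  have hpos : 0 < b ^ h := by positivity
  refine card_le_card_of_injOn (fun x => (Fin.ofNat (h+1) x.1,
    (⟨((x.2+1) * b ^ (m - x.1) - 1) % b ^ h, Nat.mod_lt _ hpos⟩ : Fin (b ^ h)))) ?_ ?_
  · intro x hx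
    obtain ⟨h1, h2, h3, h4⟩ := hbnd x hx
    have h5 := hj x hx
    have h6 : x.1 % (h+1) = x.1 := Nat.mod_eq_of_lt (by omega)
    simp only [nzNodes, coe_filter, mem_univ, true_and, Set.mem_ofPred_eq, Fin.ofNat, h6,
      Nat.mod_eq_of_lt h5]
    exact ⟨Or.inr h4, altVec_node b T m s k x.1 x.2 hb h1 h2 h3 hT⟩
  · intro x hx y hy he
    obtain ⟨h1, h2, h3, h4⟩ := hbnd x hx
    obtain ⟨h1', h2', h3', h4'⟩ := hbnd y hy
    have h5 := hj x hx
    have h5' := hj y hy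
    simp only [Prod.mk.injEq, Fin.ext_iff, Fin.ofNat, Nat.mod_eq_of_lt h5,
      Nat.mod_eq_of_lt h5'] at he
    obtain ⟨e1, e2⟩ := he
    rw [Nat.mod_eq_of_lt (by omega), Nat.mod_eq_of_lt (by omega)] at e1
    rw [← e1] at e2
    have p1 : 0 < (x.2+1) * b ^ (m - x.1) := by positivity
    have p2 : 0 < (y.2+1) * b ^ (m - x.1) := by positivity
    have e3 : (x.2+1) * b ^ (m - x.1) = (y.2+1) * b ^ (m - x.1) := by omega
    have e4 := Nat.eq_of_mul_eq_mul_right (by positivity) e3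
    exact Prod.ext e1 (by omega)

open Finset in
/-- root version -/
theorem lower_root (b h T : ℕ) (hb : 2 ≤ b) (h1 : 1 ≤ h) (hTh : T ≤ b ^ h)
    (hT : b ^ (h-1) ≤ T) :
    h ≤ (nzNodes b h T (altVec (b ^ (h-1)) 0 1 T)).card := by
  classical
  have hpos : 0 < b ^ h := by positivity
  have hlt : ∀ l, b ^ (h - 1 - l) - 1 < b ^ h := by
    intro l
    have : b ^ (h - 1 - l) ≤ b ^ h := Nat.pow_le_pow_right (by omega) (by omega)
    omega
  conv_lhs => rw [← card_range h]
  refine card_le_card_of_injOn (fun l => if l = h - 1 then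
    ((⟨h, by omega⟩ : Fin (h+1)), (⟨0, hpos⟩ : Fin (b ^ h))) else (Fin.ofNat (h+1) l,
    (⟨b ^ (h - 1 - l) - 1, hlt l⟩ : Fin (b ^ h)))) ?_ ?_
  · intro l hl
    simp only [coe_range, Set.mem_Iio] at hl
    simp only [nzNodes, coe_filter, mem_univ, true_and, Set.mem_ofPred_eq]
    split_ifs with hl'
    · refine ⟨Or.inl rfl, ?_⟩
      have e : nodeVal b T (altVec (b ^ (h-1)) 0 1 T) h 0 =
          ∑ t : Fin T, if 0 ≤ (t:ℕ) ∧ (t:ℕ) < T then altVec (b ^ (h-1)) 0 1 T t else 0 := by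
        unfold nodeVal
        refine sum_congr rfl fun t _ => ?_
        have := t.2
        rw [if_pos (by constructor <;> omega), if_pos (by constructor <;> omega)]
      simp only
      rw [e]
      unfold altVec
      rw [sum_tele (fun n => ((cnt (b ^ (h-1)) 0 1 n % 2 : ℕ) : ℤ)) _ _ (by omega) le_rfl]
      have : 1 ≤ T / b ^ (h-1) := (Nat.one_le_div_iff (by positivity)).2 hT
      unfold cnt
      simp only [Nat.zero_div]
      omega
    · have h6 : l % (h+1) = l := Nat.mod_eq_of_lt (by omega)
      simp only [Fin.ofNat, h6]
      constructor
      · right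
        simpa using mod_pred b 1 (h - 1 - l) hb le_rfl (by omega)
      · simpa using altVec_node b T (h-1) 0 1 l 0 hb (by omega) le_rfl (by omega) (by simpa using hT)
  · intro x hx y hy he
    simp only [coe_range, Set.mem_Iio] at hx hy
    have hx' : x % (h+1) = x := Nat.mod_eq_of_lt (by omega)
    have hy' : y % (h+1) = y := Nat.mod_eq_of_lt (by omega)
    simp only at he
    split_ifs at he with c1 c2 c2 <;> 
    simp only [Prod.mk.injEq, Fin.ext_iff, Fin.ofNat, hx', hy'] at he <;> omega

open Finset in
theorem count1 (b k : ℕ) (hb : 0 < b) :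
    (k : ℝ) * (1 - 1 / b) ≤ (((Ico 1 (1+k)).filter fun i => i % b ≠ 0).card : ℝ) := by
  have h1 := card_filter_add_card_filter_not (s := Ico 1 (1+k)) (fun i => b ∣ i)
  have h2 : ((Ico 1 (1+k)).filter fun i => b ∣ i).card = k / b := by
    rw [← Nat.Ioc_filter_dvd_card_eq_div]
    congr 2
    ext; simp; omega
  have h3 : ((Ico 1 (1+k)).filter fun i => ¬ b ∣ i) = ((Ico 1 (1+k)).filter fun i => i % b ≠ 0) := by
    simp only [Nat.dvd_iff_mod_eq_zero, ne_eq]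
  rw [h2, h3, Nat.card_Ico, Nat.add_sub_cancel_left] at h1
  have h4 : ((k / b : ℕ) : ℝ) ≤ (k:ℝ) / b := Nat.cast_div_le
  have h5 : ((k / b : ℕ) : ℝ) + (((Ico 1 (1+k)).filter fun i => i % b ≠ 0).card : ℝ) = k := by
    exact_mod_cast h1
  have : (k:ℝ) * (1 - 1/b) = k - k / b := by ring
  linarith

open Finset in
theorem count0 (b k : ℕ) (hb : 0 < b) (hbk : b ∣ k) :
    (k : ℝ) * (1 - 1 / b) ≤ (((Ico 0 (0+k)).filter fun i => i % b ≠ 0).card : ℝ) := by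
  refine (count1 b k hb).trans ?_
  norm_cast
  apply card_le_card
  intro i hi
  simp only [mem_filter, mem_Ico] at hi ⊢
  have : i ≠ k := by
    rintro rfl
    exact hi.2 (Nat.mod_eq_zero_of_dvd hbk)
  exact ⟨by omega, hi.2⟩

theorem stmt17 (b T k : ℕ) (hb : 3 ≤ b) (hbT : b ≤ T) (hk1 : 1 ≤ k) (hkT : k ≤ T)
    (p : ℝ) (hp : 1 ≤ p)
    (h : ℕ) (hh : h = Nat.clog b T)
    (kt : ℕ) (hkt : kt = min k (b ^ (h - 1))) :
    ((kt : ℝ) * ((Nat.clog b T : ℝ) - (Nat.clog b kt : ℝ) - 1 / (b : ℝ)) ≤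
        sens p (nodeMatrixHatT b h T) (SDk T 1 k) ^ p ∧
      sens p (nodeMatrixHatT b h T) (SDk T 1 k) ^ p ≤
        (k : ℝ) * ((⌈Real.logb (b : ℝ) ((T : ℝ) / (k : ℝ))⌉ : ℝ) + 2)) ∧
      (b * k ≤ T →
        (k : ℝ) * ((⌊Real.logb (b : ℝ) ((T : ℝ) / (k : ℝ))⌋ : ℝ) - 1 / (b : ℝ)) ≤
          sens p (nodeMatrixHatT b h T) (SDk T 1 k) ^ p) := by
  have hb2 : 1 < b := by omega
  have hTh : T ≤ b ^ h := hh ▸ Nat.le_pow_clog hb2 T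
  have h1 : 1 ≤ h := by
    rw [hh]; exact Nat.clog_pos hb2 (by omega)
  have hTl : b ^ (h-1) < T := by
    rw [hh]; exact Nat.pow_pred_clog_lt_self hb2 (by omega)
  have hbR : (1:ℝ) < b := by exact_mod_cast hb2
  have hkR : (0:ℝ) < k := by exact_mod_cast hk1
  have hTR : (0:ℝ) < T := by exact_mod_cast (by omega : 0 < T)
  have hk1R : (1:ℝ) ≤ T / k := by
    rw [le_div_iff₀ hkR, one_mul]; exact_mod_cast hkT
  have hlog0 : 0 ≤ Real.logb (b:ℝ) (T/k) := Real.logb_nonneg hbR hk1R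
  refine ⟨⟨?_, ?_⟩, ?_⟩
  · rw [← hh]
    have hktk : kt ≤ k := by omega
    have hktb : kt ≤ b ^ (h-1) := by omega
    have hkt1 : 1 ≤ kt := by
      have : 0 < b ^ (h-1) := by positivity
      omega
    set c := Nat.clog b kt with hc
    have hktc : kt ≤ b ^ c := Nat.le_pow_clog hb2 kt
    have hch : c ≤ h - 1 := Nat.clog_le_of_le_pow hktb
    have hcm : b ^ c * b ^ (h-1-c) = b ^ (h-1) := by
      rw [← pow_add]; congr 1; omega
    have hmR : ((h - 1 - c : ℕ) : ℝ) = h - 1 - c := by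
      rw [Nat.cast_sub (by omega), Nat.cast_sub (by omega)]; simp
    rcases Nat.lt_or_ge kt (b ^ c) with hlt | hge
    · have hT : (1 + kt) * b ^ (h-1-c) ≤ T := by
        have : (1 + kt) * b ^ (h-1-c) ≤ b ^ c * b ^ (h-1-c) := Nat.mul_le_mul_right _ (by omega)
        omega
      have hl := lower b h T (h-1-c) 1 kt (by omega) (by omega) hTh hT
      have hs := le_sens_s17 b h T k p hp _ (altVec_mem (b ^ (h-1-c)) 1 kt k T hktk)
      have hl' : (kt:ℝ) * ((h-1-c : ℕ):ℝ) +
        (((Finset.Ico 1 (1+kt)).filter fun i => i % b ≠ 0).card : ℝ) ≤ _ :=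
        le_trans (by exact_mod_cast hl) hs
      have hcount := count1 b kt (by omega)
      rw [hmR] at hl'
      refine le_trans ?_ hl'
      linear_combination hcount
    · have hkc : kt = b ^ c := le_antisymm hktc hge
      rcases Nat.eq_zero_or_pos c with h0 | h0
      · have hl := lower_root b h T (by omega) h1 hTh hTl.le
        have hs := le_sens_s17 b h T k p hp _ (altVec_mem (b ^ (h-1)) 0 1 k T hk1)
        refine le_trans ?_ (le_trans (Nat.cast_le.2 hl) hs)
        rw [hkc, h0]
        have : (0:ℝ) ≤ 1 / b := by positivity
        simp only [pow_zero, Nat.cast_one, Nat.cast_zero]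
        linarith
      · have hT : (0 + kt) * b ^ (h-1-c) ≤ T := by
          rw [zero_add, hkc, hcm]; exact hTl.le
        have hl := lower b h T (h-1-c) 0 kt (by omega) (by omega) hTh hT
        have hs := le_sens_s17 b h T k p hp _ (altVec_mem (b ^ (h-1-c)) 0 kt k T hktk)
        have hl' : (kt:ℝ) * ((h-1-c : ℕ):ℝ) +
          (((Finset.Ico 0 (0+kt)).filter fun i => i % b ≠ 0).card : ℝ) ≤ _ :=
          le_trans (by exact_mod_cast hl) hs
        have hcount := count0 b kt (by omega) (hkc ▸ dvd_pow_self b (by omega))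
        rw [hmR] at hl'
        refine le_trans ?_ hl'
        linear_combination hcount
  · obtain ⟨c, hc⟩ := Int.eq_ofNat_of_zero_le (Int.ceil_nonneg hlog0)
    have hle : Real.logb (b:ℝ) (T/k) ≤ (c:ℝ) := by
      have := Int.le_ceil (Real.logb (b:ℝ) (T/k))
      rw [hc] at this; exact_mod_cast this
    rw [Real.logb_le_iff_le_rpow hbR (by positivity), Real.rpow_natCast, div_le_iff₀ hkR,
      mul_comm] at hle
    have hle' : T ≤ k * b ^ c := by exact_mod_cast hle
    have := sens_le b h T k p hp _ (fun Δ hΔ => upper b h T k c (by omega) hle' Δ hΔ)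
    rw [hc]
    push_cast at this ⊢
    nlinarith
  · intro hbk
    obtain ⟨f, hf⟩ := Int.eq_ofNat_of_zero_le (Int.floor_nonneg.2 hlog0)
    have hle : (f:ℝ) ≤ Real.logb (b:ℝ) (T/k) := by
      have := Int.floor_le (Real.logb (b:ℝ) (T/k))
      rw [hf] at this; exact_mod_cast this
    rw [Real.le_logb_iff_rpow_le hbR (by positivity), Real.rpow_natCast, le_div_iff₀ hkR] at hle
    have hle' : b ^ f * k ≤ T := by exact_mod_cast hle
    have hf1 : 1 ≤ f := by
      have : (1:ℤ) ≤ ⌊Real.logb (b:ℝ) (T/k)⌋ := by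
        rw [Int.le_floor, Real.le_logb_iff_rpow_le hbR (by positivity), le_div_iff₀ hkR]
        simp only [Int.cast_one, Real.rpow_one]
        exact_mod_cast hbk
      rw [hf] at this
      exact_mod_cast this
    have hfh : f ≤ h := by
      have : b ^ f ≤ b ^ h := le_trans (Nat.le_mul_of_pos_right _ hk1) (hle'.trans hTh)
      exact (Nat.pow_le_pow_iff_right hb2).1 this
    have hT : (1 + k) * b ^ (f-1) ≤ T := by
      have e : b ^ f = b ^ (f-1) * b := by
        rw [← pow_succ]; congr 1; omega
      have : (1 + k) * b ^ (f-1) ≤ (b * k) * b ^ (f-1) := Nat.mul_le_mul_right _ (by nlinarith)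
      calc _ ≤ _ := this
        _ = b ^ f * k := by rw [e]; ring
        _ ≤ T := hle'
    have hl := lower b h T (f-1) 1 k (by omega) (by omega) hTh hT
    have hs := le_sens_s17 b h T k p hp _ (altVec_mem (b ^ (f-1)) 1 k k T le_rfl)
    have hl' : (k:ℝ) * ((f-1 : ℕ):ℝ) +
      (((Finset.Ico 1 (1+k)).filter fun i => i % b ≠ 0).card : ℝ) ≤ _ :=
      le_trans (by exact_mod_cast hl) hs
    have hcount := count1 b k (by omega)
    rw [Nat.cast_sub hf1] at hl'
    rw [hf]
    refine le_trans ?_ hl'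
    push_cast
    linear_combination hcount
end
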